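/- arXiv:1011.1643 — 2 statements merged into one kernel-verified Lean document; each statement's English description precedes it below -/
import Mathlib

section
/- For every τ in the upper half-plane and every z ∈ ℂ with θ₁(z|τ) ≠ 0, the differential identity θ₃(z|τ)·θ₄'(z|τ) - θ₄(z|τ)·θ₃'(z|τ) = π·ϑ₂(τ)²·θ₁(z|τ)·θ₂(z|τ) holds, where primes denote ∂/∂z. -/
open Complex

/-- Jacobi's θ₁. -/
noncomputable def jtheta1 (z τ : ℂ) : ℂ :=
  -I * Complex.exp ((Real.pi : ℂ) * I * τ / 4) *
    ∑' k : ℤ, (-1 : ℂ) ^ k * Complex.exp (((k : ℂ) ^ 2 + (k : ℂ)) * (Real.pi : ℂ) * I * τ)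
      * Complex.exp ((2 * (k : ℂ) + 1) * (Real.pi : ℂ) * I * z)

/-- Jacobi's θ₂. -/
noncomputable def jtheta2 (z τ : ℂ) : ℂ :=
  Complex.exp ((Real.pi : ℂ) * I * τ / 4) *
    ∑' k : ℤ, Complex.exp (((k : ℂ) ^ 2 + (k : ℂ)) * (Real.pi : ℂ) * I * τ)
      * Complex.exp ((2 * (k : ℂ) + 1) * (Real.pi : ℂ) * I * z)

/-- Jacobi's θ₃. -/
noncomputable def jtheta3 (z τ : ℂ) : ℂ :=
  ∑' k : ℤ, Complex.exp ((k : ℂ) ^ 2 * (Real.pi : ℂ) * I * τ)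
    * Complex.exp (2 * (k : ℂ) * (Real.pi : ℂ) * I * z)

/-- Jacobi's θ₄. -/
noncomputable def jtheta4 (z τ : ℂ) : ℂ :=
  ∑' k : ℤ, (-1 : ℂ) ^ k * Complex.exp ((k : ℂ) ^ 2 * (Real.pi : ℂ) * I * τ)
    * Complex.exp (2 * (k : ℂ) * (Real.pi : ℂ) * I * z)

open Filter Topology

/-- Pairs of integers, split according to the parity of their sum and difference. -/
noncomputable def intPairParityEquiv : (ℤ × ℤ) ⊕ (ℤ × ℤ) ≃ ℤ × ℤ :=
  Equiv.ofBijective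
    (Sum.elim (fun p => (p.1 + p.2, p.1 - p.2)) (fun p => (p.1 + p.2 + 1, p.1 - p.2))) <| by
    constructor
    · rintro (⟨a, b⟩ | ⟨a, b⟩) (⟨c, d⟩ | ⟨c, d⟩) h <;>
        simp only [Sum.elim_inl, Sum.elim_inr, Prod.mk.injEq, Sum.inl.injEq, Sum.inr.injEq,
          reduceCtorEq] at h ⊢ <;> omega
    · rintro ⟨m, n⟩
      rcases Int.even_or_odd' (m + n) with ⟨r, h | h⟩
      · exact ⟨Sum.inl (r, m - r), by simp only [Sum.elim_inl, Prod.mk.injEq]; omega⟩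
      · exact ⟨Sum.inr (r, m - r - 1), by simp only [Sum.elim_inr, Prod.mk.injEq]; omega⟩

theorem intPairParityEquiv_inl (r s : ℤ) :
    intPairParityEquiv (Sum.inl (r, s)) = (r + s, r - s) := rfl

theorem intPairParityEquiv_inr (r s : ℤ) :
    intPairParityEquiv (Sum.inr (r, s)) = (r + s + 1, r - s) := rfl

theorem hasSum_jacobiTheta₂_term_mul {σ : ℂ} (hσ : 0 < σ.im) (x y : ℂ) :
    HasSum (fun p : ℤ × ℤ => jacobiTheta₂_term p.1 x σ * jacobiTheta₂_term p.2 y σ)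
      (jacobiTheta₂ x σ * jacobiTheta₂ y σ) := by
  have hx := hasSum_jacobiTheta₂_term x hσ
  have hy := hasSum_jacobiTheta₂_term y hσ
  have hs := summable_mul_of_summable_norm hx.summable.norm hy.summable.norm
  have h := tsum_mul_tsum_of_summable_norm hx.summable.norm hy.summable.norm
  rw [hx.tsum_eq, hy.tsum_eq] at h
  rw [h]
  exact hs.hasSum

theorem two_mul_im_pos {τ : ℂ} (hτ : 0 < τ.im) : 0 < (2 * τ).im := by
  simpa using hτ

/-- The product of two theta functions in terms of theta functions of parameter `2 * τ`. -/
theorem jacobiTheta₂_mul_jacobiTheta₂ {τ : ℂ} (hτ : 0 < τ.im) (x y : ℂ) :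
    jacobiTheta₂ x τ * jacobiTheta₂ y τ =
      jacobiTheta₂ (x + y) (2 * τ) * jacobiTheta₂ (x - y) (2 * τ) +
      Complex.exp (Real.pi * I * (τ + 2 * x)) *
        (jacobiTheta₂ (x + y + τ) (2 * τ) * jacobiTheta₂ (x - y + τ) (2 * τ)) := by
  have h2 := two_mul_im_pos hτ
  refine (intPairParityEquiv.hasSum_iff.mpr (hasSum_jacobiTheta₂_term_mul hτ x y)).unique ?_
  refine HasSum.sum ?_ ?_
  · convert hasSum_jacobiTheta₂_term_mul h2 (x + y) (x - y) using 1
    refine funext fun ⟨r, s⟩ => ?_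
    simp only [Function.comp_apply, intPairParityEquiv_inl, jacobiTheta₂_term, ← Complex.exp_add]
    push_cast
    ring_nf
  · have h : HasSum (fun p : ℤ × ℤ => Complex.exp (Real.pi * I * (τ + 2 * x)) *
        (jacobiTheta₂_term p.1 (x + y + τ) (2 * τ) * jacobiTheta₂_term p.2 (x - y + τ) (2 * τ))) _ :=
      (hasSum_jacobiTheta₂_term_mul h2 (x + y + τ) (x - y + τ)).mul_left _
    convert h using 1
    refine funext fun ⟨r, s⟩ => ?_
    simp only [Function.comp_apply, intPairParityEquiv_inr, jacobiTheta₂_term, ← Complex.exp_add]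
    push_cast
    ring_nf

/-- The zero of the theta function at the sum of the two half periods. -/
theorem jacobiTheta₂_half_add_half (τ : ℂ) : jacobiTheta₂ (1 / 2 + τ / 2) τ = 0 := by
  have h1 := jacobiTheta₂_add_left' (1 / 2 - τ / 2) τ
  have h2 : jacobiTheta₂ (1 / 2 - τ / 2) τ = jacobiTheta₂ (1 / 2 + τ / 2) τ := by
    rw [← jacobiTheta₂_neg_left, ← jacobiTheta₂_add_left]
    ring_nf
  have h3 : Complex.exp (-Real.pi * I * (τ + 2 * (1 / 2 - τ / 2))) = -1 := by
    rw [show -(Real.pi : ℂ) * I * (τ + 2 * (1 / 2 - τ / 2)) = -(Real.pi * I) by ring,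
      Complex.exp_neg, Complex.exp_pi_mul_I]
    norm_num
  rw [h2, h3, show 1 / 2 - τ / 2 + τ = 1 / 2 + τ / 2 by ring] at h1
  linear_combination h1 / 2

theorem jacobiTheta₂_half_add (τ : ℂ) : jacobiTheta₂ (1 / 2 + τ) (2 * τ) = 0 := by
  simpa using jacobiTheta₂_half_add_half (2 * τ)

theorem jacobiTheta₂'_half (τ : ℂ) : jacobiTheta₂' (1 / 2) τ = 0 := by
  have h1 := jacobiTheta₂'_add_left (-(1 / 2)) τ
  rw [jacobiTheta₂'_neg_left, show -(1 / 2 : ℂ) + 1 = 1 / 2 by norm_num] at h1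
  linear_combination h1 / 2

theorem jacobiTheta₂_shift_mul_shift {τ : ℂ} (hτ : 0 < τ.im) (z : ℂ) :
    jacobiTheta₂ (z + (1 / 2 + τ / 2)) τ * jacobiTheta₂ (z + τ / 2) τ =
      jacobiTheta₂ (2 * z + (1 / 2 + τ)) (2 * τ) * jacobiTheta₂ (1 / 2) (2 * τ) := by
  rw [jacobiTheta₂_mul_jacobiTheta₂ hτ,
    show z + (1 / 2 + τ / 2) - (z + τ / 2) + τ = 1 / 2 + τ by ring, jacobiTheta₂_half_add,
    show z + (1 / 2 + τ / 2) - (z + τ / 2) = 1 / 2 by ring,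
    show z + (1 / 2 + τ / 2) + (z + τ / 2) = 2 * z + (1 / 2 + τ) by ring]
  ring

theorem jacobiTheta₂_half_period_sq {τ : ℂ} (hτ : 0 < τ.im) :
    jacobiTheta₂ (τ / 2) τ ^ 2 =
      2 * jacobiTheta₂ τ (2 * τ) * jacobiTheta₂ 0 (2 * τ) := by
  have h := jacobiTheta₂_add_left' 0 (2 * τ)
  have he : Complex.exp (Real.pi * I * (τ + 2 * (τ / 2))) *
      Complex.exp (-Real.pi * I * (2 * τ + 2 * 0)) = 1 := by
    rw [← Complex.exp_add, ← Complex.exp_zero]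
    ring_nf
  rw [sq, jacobiTheta₂_mul_jacobiTheta₂ hτ, sub_self, zero_add,
    show τ / 2 + τ / 2 + τ = 0 + 2 * τ by ring, h, add_halves]
  linear_combination jacobiTheta₂ 0 (2 * τ) * jacobiTheta₂ τ (2 * τ) * he

theorem jacobiTheta₂_half_mul_zero {τ : ℂ} (hτ : 0 < τ.im) :
    jacobiTheta₂ 0 τ * jacobiTheta₂ (1 / 2) τ = jacobiTheta₂ (1 / 2) (2 * τ) ^ 2 := by
  rw [mul_comm, jacobiTheta₂_mul_jacobiTheta₂ hτ, add_zero, sub_zero, jacobiTheta₂_half_add]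
  ring

theorem jacobiTheta₂'_half_add_half_mul {τ : ℂ} (hτ : 0 < τ.im) :
    jacobiTheta₂' (1 / 2 + τ / 2) τ * jacobiTheta₂ (τ / 2) τ =
      2 * jacobiTheta₂' (1 / 2 + τ) (2 * τ) * jacobiTheta₂ (1 / 2) (2 * τ) := by
  have h1 : HasDerivAt (fun z => jacobiTheta₂ (z + (1 / 2 + τ / 2)) τ)
      (jacobiTheta₂' (0 + (1 / 2 + τ / 2)) τ) 0 :=
    (hasDerivAt_jacobiTheta₂_fst _ hτ).comp_add_const _ _
  have h2 : HasDerivAt (fun z => jacobiTheta₂ (z + τ / 2) τ)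
      (jacobiTheta₂' (0 + τ / 2) τ) 0 :=
    (hasDerivAt_jacobiTheta₂_fst _ hτ).comp_add_const _ _
  have h3 : HasDerivAt (fun z => jacobiTheta₂ (2 * z + (1 / 2 + τ)) (2 * τ))
      (jacobiTheta₂' (2 * 0 + (1 / 2 + τ)) (2 * τ) * (2 * 1)) 0 :=
    (hasDerivAt_jacobiTheta₂_fst _ (two_mul_im_pos hτ)).comp (0 : ℂ)
      (((hasDerivAt_id' (0 : ℂ)).const_mul 2).add_const _)
  have h := (h1.mul h2).unique ((h3.mul_const (jacobiTheta₂ (1 / 2) (2 * τ))).congr_of_eventuallyEq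
    (Eventually.of_forall (jacobiTheta₂_shift_mul_shift hτ)))
  simp only [zero_add, mul_zero, jacobiTheta₂_half_add_half, zero_mul, add_zero] at h
  linear_combination h

/-- The Wronskian of `z ↦ θ(z)` and `z ↦ θ(z + 1/2)`, factored at parameter `2 * τ`. -/
theorem jacobiTheta₂_wronskian {τ : ℂ} (hτ : 0 < τ.im) (z : ℂ) :
    jacobiTheta₂ z τ * jacobiTheta₂' (z + 1 / 2) τ -
        jacobiTheta₂ (z + 1 / 2) τ * jacobiTheta₂' z τ =
      -2 * Complex.exp (Real.pi * I * (τ + 2 * z)) * jacobiTheta₂ (2 * z + (1 / 2 + τ)) (2 * τ) *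
        jacobiTheta₂' (1 / 2 + τ) (2 * τ) := by
  have h2τ := two_mul_im_pos hτ
  have h1 : HasDerivAt (fun t => jacobiTheta₂ (z + 1 / 2 + t) τ)
      (jacobiTheta₂' (z + 1 / 2 + 0) τ) 0 :=
    (hasDerivAt_jacobiTheta₂_fst _ hτ).comp_const_add _ _
  have h2 : HasDerivAt (fun t => jacobiTheta₂ (z - t) τ) (-jacobiTheta₂' (z - 0) τ) 0 :=
    (hasDerivAt_jacobiTheta₂_fst _ hτ).comp_const_sub _ _
  have h3 (c : ℂ) : HasDerivAt (fun t => jacobiTheta₂ (2 * t + c) (2 * τ))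
      (jacobiTheta₂' (2 * 0 + c) (2 * τ) * (2 * 1)) 0 :=
    (hasDerivAt_jacobiTheta₂_fst _ h2τ).comp (0 : ℂ)
      (((hasDerivAt_id' (0 : ℂ)).const_mul 2).add_const _)
  have h4 : HasDerivAt (fun t : ℂ => Complex.exp (Real.pi * I * (τ + 2 * (z + 1 / 2 + t))))
      (Complex.exp (Real.pi * I * (τ + 2 * (z + 1 / 2 + 0))) * (Real.pi * I * (2 * 1))) 0 :=
    (((((hasDerivAt_id' (0 : ℂ)).const_add _).const_mul 2).const_add _).const_mul _).cexp
  have key (t : ℂ) : jacobiTheta₂ (z + 1 / 2 + t) τ * jacobiTheta₂ (z - t) τ =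
      jacobiTheta₂ (2 * z + 1 / 2) (2 * τ) * jacobiTheta₂ (2 * t + 1 / 2) (2 * τ) +
      Complex.exp (Real.pi * I * (τ + 2 * (z + 1 / 2 + t))) *
        (jacobiTheta₂ (2 * z + (1 / 2 + τ)) (2 * τ) *
          jacobiTheta₂ (2 * t + (1 / 2 + τ)) (2 * τ)) := by
    rw [jacobiTheta₂_mul_jacobiTheta₂ hτ]
    ring_nf
  have h := (h1.mul h2).unique ((((h3 (1 / 2)).const_mul _).add
    (h4.mul ((h3 (1 / 2 + τ)).const_mul _))).congr_of_eventuallyEq (Eventually.of_forall key))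
  have he : Complex.exp (Real.pi * I * (τ + 2 * (z + 1 / 2))) =
      -Complex.exp (Real.pi * I * (τ + 2 * z)) := by
    rw [show (Real.pi : ℂ) * I * (τ + 2 * (z + 1 / 2)) =
      Real.pi * I * (τ + 2 * z) + Real.pi * I by ring, Complex.exp_add, Complex.exp_pi_mul_I]
    ring
  simp only [add_zero, sub_zero, mul_zero, zero_add, jacobiTheta₂_half_add, jacobiTheta₂'_half,
    he] at h
  linear_combination h

/-- Tannery's theorem for a series in powers of the nome, as `im τ → ∞`. -/
theorem tendsto_tsum_mul_cexp_im_atTop (c : ℤ → ℂ) (e : ℤ → ℤ) (he : ∀ n, 0 ≤ e n)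
    (hs : Summable fun n => c n * Complex.exp (Real.pi * I * e n * I)) :
    Tendsto (fun τ : ℂ => ∑' n, c n * Complex.exp (Real.pi * I * e n * τ)) (comap im atTop)
      (𝓝 (∑' n, if e n = 0 then c n else 0)) := by
  have hnorm (n : ℤ) (τ : ℂ) :
      ‖Complex.exp (Real.pi * I * e n * τ)‖ = Real.exp (-(Real.pi * e n * τ.im)) := by
    rw [Complex.norm_exp]
    congr 1
    simp
  refine tendsto_tsum_of_dominated_convergence hs.norm (fun n => ?_) ?_
  · split_ifs with h
    · simpa [h] using tendsto_const_nhds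
    · have hpos : 0 < Real.pi * e n :=
        mul_pos Real.pi_pos (by exact_mod_cast lt_of_le_of_ne (he n) (Ne.symm h))
      have : Tendsto (fun τ : ℂ => Complex.exp (Real.pi * I * e n * τ)) (comap im atTop) (𝓝 0) := by
        rw [tendsto_zero_iff_norm_tendsto_zero]
        simp_rw [hnorm]
        exact Real.tendsto_exp_neg_atTop_nhds_zero.comp
          (tendsto_comap.const_mul_atTop hpos)
      simpa using this.const_mul (c n)
  · filter_upwards [tendsto_comap.eventually (eventually_ge_atTop 1)] with τ hτ n
    rw [norm_mul, norm_mul, hnorm, hnorm]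
    have : (0 : ℝ) ≤ e n := by exact_mod_cast he n
    gcongr
    simpa using hτ

theorem tendsto_jacobiTheta₂_zero : Tendsto (jacobiTheta₂ 0) (comap im atTop) (𝓝 1) := by
  have h := tendsto_tsum_mul_cexp_im_atTop (fun _ => 1) (fun n => n ^ 2)
    (fun n => sq_nonneg n) <| by
    refine (hasSum_jacobiTheta₂_term 0 (τ := I) (by simp)).summable.congr fun n => ?_
    simp [jacobiTheta₂_term]
  convert h using 2
  · refine tsum_congr fun n => ?_
    simp [jacobiTheta₂_term]
  · simp

theorem cexp_two_pi_mul_int_half (n : ℤ) :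
    Complex.exp (2 * Real.pi * I * n * (1 / 2)) = (-1) ^ n := by
  rw [show 2 * (Real.pi : ℂ) * I * n * (1 / 2) = n * (Real.pi * I) by ring, Complex.exp_int_mul,
    Complex.exp_pi_mul_I]

theorem tendsto_jacobiTheta₂_half : Tendsto (jacobiTheta₂ (1 / 2)) (comap im atTop) (𝓝 1) := by
  have hterm (n : ℤ) (τ : ℂ) : jacobiTheta₂_term n (1 / 2) τ =
      (-1) ^ n * Complex.exp (Real.pi * I * (n ^ 2 : ℤ) * τ) := by
    rw [jacobiTheta₂_term, Complex.exp_add, cexp_two_pi_mul_int_half]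
    push_cast
    rfl
  have h := tendsto_tsum_mul_cexp_im_atTop (fun n => (-1) ^ n) (fun n => n ^ 2)
    (fun n => sq_nonneg n) <|
    (hasSum_jacobiTheta₂_term (1 / 2) (τ := I) (by simp)).summable.congr fun n => hterm n I
  convert h using 2
  · exact tsum_congr fun n => hterm n _
  · simp [tsum_ite_eq]

theorem int_sq_add_self_nonneg (n : ℤ) : 0 ≤ n ^ 2 + n := by
  rcases le_or_gt 0 n with h | h <;> nlinarith

theorem tsum_ite_int_sq_add_self_eq_zero (c : ℤ → ℂ) :
    ∑' n : ℤ, (if n ^ 2 + n = 0 then c n else 0) = c 0 + c (-1) := by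
  rw [tsum_eq_sum (s := {0, -1})]
  · simp
  · intro n hn
    refine if_neg fun h => hn ?_
    rcases mul_eq_zero.mp (show n * (n + 1) = 0 by linarith) with h | h
    · simp [h]
    · simp [eq_neg_of_add_eq_zero_left h]

theorem tendsto_jacobiTheta₂_half_period :
    Tendsto (fun τ => jacobiTheta₂ (τ / 2) τ) (comap im atTop) (𝓝 2) := by
  have hterm (n : ℤ) (τ : ℂ) : jacobiTheta₂_term n (τ / 2) τ =
      1 * Complex.exp (Real.pi * I * (n ^ 2 + n : ℤ) * τ) := by
    rw [jacobiTheta₂_term]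
    push_cast
    ring_nf
  have h := tendsto_tsum_mul_cexp_im_atTop (fun _ => 1) (fun n => n ^ 2 + n)
    int_sq_add_self_nonneg <|
    (hasSum_jacobiTheta₂_term (I / 2) (τ := I) (by simp)).summable.congr fun n => hterm n I
  rw [tsum_ite_int_sq_add_self_eq_zero, one_add_one_eq_two] at h
  exact h.congr fun τ => (tsum_congr fun n => hterm n τ).symm

theorem tendsto_jacobiTheta₂'_half_add_half :
    Tendsto (fun τ => jacobiTheta₂' (1 / 2 + τ / 2) τ) (comap im atTop)
      (𝓝 (2 * Real.pi * I)) := by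
  have hterm (n : ℤ) (τ : ℂ) : jacobiTheta₂'_term n (1 / 2 + τ / 2) τ =
      2 * Real.pi * I * n * (-1) ^ n * Complex.exp (Real.pi * I * (n ^ 2 + n : ℤ) * τ) := by
    rw [jacobiTheta₂'_term, jacobiTheta₂_term, ← cexp_two_pi_mul_int_half,
      mul_assoc _ (Complex.exp _), ← Complex.exp_add]
    push_cast
    ring_nf
  have h := tendsto_tsum_mul_cexp_im_atTop (fun n => 2 * Real.pi * I * n * (-1) ^ n)
    (fun n => n ^ 2 + n) int_sq_add_self_nonneg <|
    (hasSum_jacobiTheta₂'_term (1 / 2 + I / 2) (τ := I) (by simp)).summable.congr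
      fun n => hterm n I
  rw [tsum_ite_int_sq_add_self_eq_zero] at h
  convert h using 2
  · exact tsum_congr fun n => hterm n _
  · norm_num

/-- Jacobi's derivative formula when the imaginary part of `τ` is large. -/
theorem eventually_jacobi_derivative_formula :
    ∃ N : ℝ, 0 < N ∧ ∀ τ : ℂ, N < τ.im → jacobiTheta₂ (τ / 2) τ ≠ 0 ∧
      jacobiTheta₂' (1 / 2 + τ / 2) τ = Real.pi * I *
        (jacobiTheta₂ 0 τ * jacobiTheta₂ (1 / 2) τ * jacobiTheta₂ (τ / 2) τ) := by
  have hA := tendsto_jacobiTheta₂_zero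
  have hB := tendsto_jacobiTheta₂_half
  have hC := tendsto_jacobiTheta₂_half_period
  have hne := (hA.eventually_ne one_ne_zero).and ((hB.eventually_ne one_ne_zero).and
    (hC.eventually_ne two_ne_zero))
  obtain ⟨N, hN⟩ := eventually_atTop.mp (eventually_comap.mp hne)
  set g : ℂ → ℂ := fun τ => jacobiTheta₂' (1 / 2 + τ / 2) τ /
    (jacobiTheta₂ 0 τ * jacobiTheta₂ (1 / 2) τ * jacobiTheta₂ (τ / 2) τ) with hg
  have hlim : Tendsto g (comap im atTop) (𝓝 (Real.pi * I)) := by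
    have h := tendsto_jacobiTheta₂'_half_add_half.div ((hA.mul hB).mul hC) (by norm_num)
    rwa [show 2 * (Real.pi : ℂ) * I / (1 * 1 * 2) = Real.pi * I by ring] at h
  refine ⟨max N 1, by positivity, fun τ hτ => ?_⟩
  have hne' (σ : ℂ) (h : max N 1 < σ.im) := hN σ.im ((le_max_left _ _).trans h.le) σ rfl
  have hdouble (σ : ℂ) (h : max N 1 < σ.im) : g (2 * σ) = g σ := by
    have hpos : 0 < σ.im := lt_trans (by positivity) h
    have h2 : max N 1 < (2 * σ).im := by
      have : (2 * σ).im = 2 * σ.im := by simp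
      linarith
    obtain ⟨a, b, c⟩ := hne' σ h
    obtain ⟨a2, b2, c2⟩ := hne' (2 * σ) h2
    have e1 := jacobiTheta₂'_half_add_half_mul hpos
    have e2 := jacobiTheta₂_half_period_sq hpos
    have e3 := jacobiTheta₂_half_mul_zero hpos
    rw [mul_div_cancel_left₀ _ two_ne_zero] at c2
    simp only [hg, mul_div_cancel_left₀ _ (two_ne_zero (α := ℂ))]
    rw [div_eq_div_iff (mul_ne_zero (mul_ne_zero a2 b2) c2) (mul_ne_zero (mul_ne_zero a b) c), e3]
    refine mul_right_cancel₀ c ?_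
    linear_combination jacobiTheta₂' (1 / 2 + σ) (2 * σ) * jacobiTheta₂ (1 / 2) (2 * σ) ^ 2 * e2 -
      jacobiTheta₂ 0 (2 * σ) * jacobiTheta₂ (1 / 2) (2 * σ) * jacobiTheta₂ σ (2 * σ) * e1
  have hiter (n : ℕ) : max N 1 < (2 ^ n * τ).im ∧ g (2 ^ n * τ) = g τ := by
    induction n with
    | zero => simpa using hτ
    | succ n ih =>
      have him : (2 ^ (n + 1) * τ).im = 2 * (2 ^ n * τ).im := by
        rw [pow_succ', mul_assoc]
        simp
      refine ⟨?_, ?_⟩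
      · have : 0 < max N 1 := by positivity
        linarith [ih.1]
      · rw [pow_succ', mul_assoc, hdouble _ ih.1, ih.2]
  have hτ0 : 0 < τ.im := lt_trans (by positivity) hτ
  have hseq : Tendsto (fun n : ℕ => 2 ^ n * τ) atTop (comap im atTop) := by
    rw [tendsto_comap_iff]
    have : (im ∘ fun n : ℕ => 2 ^ n * τ) = fun n : ℕ => (2 : ℝ) ^ n * τ.im := by
      ext n
      rw [Function.comp_apply, ← im_ofReal_mul]
      push_cast
      rfl
    rw [this]
    exact (tendsto_pow_atTop_atTop_of_one_lt one_lt_two).atTop_mul_const hτ0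
  have hgτ : g τ = Real.pi * I :=
    tendsto_nhds_unique (tendsto_const_nhds.congr fun n => (hiter n).2.symm) (hlim.comp hseq)
  obtain ⟨a, b, c⟩ := hne' τ hτ
  exact ⟨c, (div_eq_iff (mul_ne_zero (mul_ne_zero a b) c)).mp hgτ⟩

theorem differentiableAt_jacobiTheta₂_half_period {τ : ℂ} (hτ : 0 < τ.im) :
    DifferentiableAt ℂ (fun τ => jacobiTheta₂ (τ / 2) τ) τ :=
  (hasFDerivAt_jacobiTheta₂ (τ / 2) hτ).differentiableAt.comp τ
    (f := fun τ : ℂ => (τ / 2, τ)) (by fun_prop)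

theorem eventually_jacobiTheta₂_half_period_ne_zero {τ : ℂ} (hτ : 0 < τ.im) :
    ∀ᶠ σ in 𝓝[≠] τ, jacobiTheta₂ (σ / 2) σ ≠ 0 := by
  by_contra hcon
  have hU : IsOpen {σ : ℂ | 0 < σ.im} := isOpen_lt continuous_const continuous_im
  have han : AnalyticOnNhd ℂ (fun σ => jacobiTheta₂ (σ / 2) σ) {σ : ℂ | 0 < σ.im} :=
    DifferentiableOn.analyticOnNhd
      (fun σ hσ => (differentiableAt_jacobiTheta₂_half_period hσ).differentiableWithinAt) hU
  have h0 := han.eqOn_zero_of_preconnected_of_frequently_eq_zero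
    (convex_halfSpace_im_gt 0).isPreconnected hτ
    (by simpa only [not_eventually, not_not] using hcon)
  obtain ⟨N, hN0, hN⟩ := eventually_jacobi_derivative_formula
  have him : (((N + 1 : ℝ) : ℂ) * I).im = N + 1 := by simp
  refine (hN (((N + 1 : ℝ) : ℂ) * I) (by linarith)).1 (h0 ?_)
  simp only [Set.mem_ofPred_eq]
  linarith

/-- Jacobi's formula for the derivative of θ₁ at zero as a product of three theta constants. -/
theorem jacobi_derivative_formula {τ : ℂ} (hτ : 0 < τ.im) :
    jacobiTheta₂' (1 / 2 + τ / 2) τ = Real.pi * I *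
      (jacobiTheta₂ 0 τ * jacobiTheta₂ (1 / 2) τ * jacobiTheta₂ (τ / 2) τ) := by
  obtain ⟨N, -, hN⟩ := eventually_jacobi_derivative_formula
  suffices H : ∀ (k : ℕ) (σ : ℂ), 0 < σ.im → N < 2 ^ k * σ.im →
      jacobiTheta₂' (1 / 2 + σ / 2) σ = Real.pi * I *
        (jacobiTheta₂ 0 σ * jacobiTheta₂ (1 / 2) σ * jacobiTheta₂ (σ / 2) σ) by
    obtain ⟨k, hk⟩ := pow_unbounded_of_one_lt (N / τ.im) one_lt_two
    exact H k τ hτ ((div_lt_iff₀ hτ).mp hk)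
  intro k
  induction k with
  | zero => exact fun σ _ h => (hN σ (by simpa using h)).2
  | succ k ih =>
    intro σ hσ hk
    have hprod (ρ : ℂ) (hρ : 0 < ρ.im) (hk : N < 2 ^ (k + 1) * ρ.im)
        (hC : jacobiTheta₂ (ρ / 2) ρ ≠ 0) :
        jacobiTheta₂' (1 / 2 + ρ / 2) ρ = Real.pi * I *
          (jacobiTheta₂ 0 ρ * jacobiTheta₂ (1 / 2) ρ * jacobiTheta₂ (ρ / 2) ρ) := by
      have e1 := jacobiTheta₂'_half_add_half_mul hρ
      have e2 := jacobiTheta₂_half_period_sq hρ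
      have e3 := jacobiTheta₂_half_mul_zero hρ
      have e4 := ih (2 * ρ) (two_mul_im_pos hρ) (by
        have : (2 * ρ).im = 2 * ρ.im := by simp
        rw [this]
        convert hk using 1
        ring)
      rw [mul_div_cancel_left₀ _ two_ne_zero] at e4
      refine mul_right_cancel₀ hC ?_
      rw [e1, e4, e3]
      linear_combination -Real.pi * I * jacobiTheta₂ (1 / 2) (2 * ρ) ^ 2 * e2
    have hopen : IsOpen {ρ : ℂ | 0 < ρ.im ∧ N < 2 ^ (k + 1) * ρ.im} :=
      (isOpen_lt continuous_const continuous_im).inter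
        (isOpen_lt continuous_const (continuous_const.mul continuous_im))
    have hev : (fun ρ => jacobiTheta₂' (1 / 2 + ρ / 2) ρ) =ᶠ[𝓝[≠] σ] fun ρ => Real.pi * I *
        (jacobiTheta₂ 0 ρ * jacobiTheta₂ (1 / 2) ρ * jacobiTheta₂ (ρ / 2) ρ) := by
      filter_upwards [eventually_jacobiTheta₂_half_period_ne_zero hσ,
        nhdsWithin_le_nhds (hopen.mem_nhds ⟨hσ, hk⟩)] with ρ h1 h2
      exact hprod ρ h2.1 h2.2 h1
    have hl : ContinuousAt (fun ρ => jacobiTheta₂' (1 / 2 + ρ / 2) ρ) σ :=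
      ContinuousAt.comp (f := fun ρ : ℂ => (1 / 2 + ρ / 2, ρ))
        (continuousAt_jacobiTheta₂' (1 / 2 + σ / 2) hσ) (by fun_prop)
    have hr : ContinuousAt (fun ρ => Real.pi * I *
        (jacobiTheta₂ 0 ρ * jacobiTheta₂ (1 / 2) ρ * jacobiTheta₂ (ρ / 2) ρ)) σ :=
      continuousAt_const.mul
        (((differentiableAt_jacobiTheta₂_snd 0 hσ).continuousAt.mul
          (differentiableAt_jacobiTheta₂_snd (1 / 2) hσ).continuousAt).mul
          (differentiableAt_jacobiTheta₂_half_period hσ).continuousAt)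
    exact tendsto_nhds_unique_of_eventuallyEq (hl.tendsto.mono_left nhdsWithin_le_nhds)
      (hr.tendsto.mono_left nhdsWithin_le_nhds) hev

theorem jtheta3_eq_jacobiTheta₂ (z τ : ℂ) : jtheta3 z τ = jacobiTheta₂ z τ := by
  refine tsum_congr fun n => ?_
  rw [jacobiTheta₂_term, ← Complex.exp_add]
  ring_nf

theorem jtheta4_eq_jacobiTheta₂ (z τ : ℂ) : jtheta4 z τ = jacobiTheta₂ (z + 1 / 2) τ := by
  refine tsum_congr fun n => ?_
  rw [jacobiTheta₂_term, ← cexp_two_pi_mul_int_half, ← Complex.exp_add, ← Complex.exp_add]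
  ring_nf

theorem jtheta2_eq_jacobiTheta₂ (z τ : ℂ) : jtheta2 z τ =
    Complex.exp (Real.pi * I * (τ / 4 + z)) * jacobiTheta₂ (z + τ / 2) τ := by
  rw [jtheta2, jacobiTheta₂, ← tsum_mul_left, ← tsum_mul_left]
  refine tsum_congr fun n => ?_
  simp only [jacobiTheta₂_term, ← Complex.exp_add]
  ring_nf

theorem jtheta1_eq_jacobiTheta₂ (z τ : ℂ) : jtheta1 z τ =
    -I * Complex.exp (Real.pi * I * (τ / 4 + z)) * jacobiTheta₂ (z + (1 / 2 + τ / 2)) τ := by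
  simp only [jtheta1, jacobiTheta₂, mul_assoc (-I), ← tsum_mul_left]
  refine tsum_congr fun n => ?_
  simp only [jacobiTheta₂_term, ← cexp_two_pi_mul_int_half, ← Complex.exp_add]
  ring_nf

theorem theta_differential_identity_34 (τ : ℂ) (hτ : 0 < τ.im) (z : ℂ)
    (hz : jtheta1 z τ ≠ 0) :
    jtheta3 z τ * deriv (fun w => jtheta4 w τ) z
      - jtheta4 z τ * deriv (fun w => jtheta3 w τ) z
      = (Real.pi : ℂ) * jtheta2 0 τ ^ 2 * jtheta1 z τ * jtheta2 z τ := by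
  have h3 : deriv (fun w => jtheta3 w τ) z = jacobiTheta₂' z τ := by
    simp only [jtheta3_eq_jacobiTheta₂]
    exact (hasDerivAt_jacobiTheta₂_fst z hτ).deriv
  have h4 : deriv (fun w => jtheta4 w τ) z = jacobiTheta₂' (z + 1 / 2) τ := by
    simp only [jtheta4_eq_jacobiTheta₂]
    exact ((hasDerivAt_jacobiTheta₂_fst _ hτ).comp_add_const _ _).deriv
  have hJ := jacobi_derivative_formula (two_mul_im_pos hτ)
  rw [mul_div_cancel_left₀ _ two_ne_zero] at hJ
  have hP := jacobiTheta₂_shift_mul_shift hτ z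
  have hC := jacobiTheta₂_half_period_sq hτ
  have he : Complex.exp (Real.pi * I * (τ / 4 + 0)) ^ 2 *
      Complex.exp (Real.pi * I * (τ / 4 + z)) ^ 2 =
      Complex.exp (Real.pi * I * (τ + 2 * z)) := by
    rw [← Complex.exp_nat_mul, ← Complex.exp_nat_mul, ← Complex.exp_add]
    push_cast
    ring_nf
  rw [h3, h4, jtheta3_eq_jacobiTheta₂, jtheta4_eq_jacobiTheta₂, jacobiTheta₂_wronskian hτ, hJ,
    ← he, jtheta2_eq_jacobiTheta₂, jtheta1_eq_jacobiTheta₂, jtheta2_eq_jacobiTheta₂, zero_add]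
  set E := Complex.exp (Real.pi * I * (τ / 4 + 0))
  set F := Complex.exp (Real.pi * I * (τ / 4 + z))
  linear_combination (Real.pi * I * E ^ 2 * F ^ 2) * (jacobiTheta₂ (τ / 2) τ ^ 2 * hP +
    jacobiTheta₂ (2 * z + (1 / 2 + τ)) (2 * τ) * jacobiTheta₂ (1 / 2) (2 * τ) * hC)
end

section
/- For every τ in the upper half-plane, 2·η(τ)³ = ϑ₂(τ)·ϑ₃(τ)·ϑ₄(τ), where η is the Dedekind eta function. -/
open Complex

/-- Dedekind's eta function. -/
noncomputable def dedekindEta (τ : ℂ) : ℂ :=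
  Complex.exp ((Real.pi : ℂ) * I * τ / 12) *
    ∏' k : ℕ, (1 - Complex.exp (2 * ((k : ℂ) + 1) * (Real.pi : ℂ) * I * τ))

noncomputable def thetaC2 (τ : ℂ) : ℂ :=
  ∑' k : ℤ, Complex.exp (((k : ℂ) + 1 / 2) ^ 2 * (Real.pi : ℂ) * I * τ)

noncomputable def thetaC3 (τ : ℂ) : ℂ :=
  ∑' k : ℤ, Complex.exp ((k : ℂ) ^ 2 * (Real.pi : ℂ) * I * τ)

noncomputable def thetaC4 (τ : ℂ) : ℂ :=
  ∑' k : ℤ, (-1 : ℂ) ^ k * Complex.exp ((k : ℂ) ^ 2 * (Real.pi : ℂ) * I * τ)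

open Filter Topology

/-- The Gaussian binomial coefficient, evaluated at `Q`. -/
def gaussBinom (Q : ℂ) : ℕ → ℕ → ℂ
  | _, 0 => 1
  | 0, _ + 1 => 0
  | M + 1, j + 1 => gaussBinom Q M j + Q ^ (j + 1) * gaussBinom Q M (j + 1)

/-- The finite product `∏_{i=1}^n (1 - Q ^ i)`. -/
def eulerProd (Q : ℂ) (n : ℕ) : ℂ := ∏ i ∈ Finset.range n, (1 - Q ^ (i + 1))

lemma gaussBinom_zero_right (Q : ℂ) (M : ℕ) : gaussBinom Q M 0 = 1 := by
  cases M <;> rfl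

lemma gaussBinom_succ_succ (Q : ℂ) (M j : ℕ) :
    gaussBinom Q (M + 1) (j + 1) =
      gaussBinom Q M j + Q ^ (j + 1) * gaussBinom Q M (j + 1) := rfl

lemma gaussBinom_eq_zero_of_lt (Q : ℂ) {M j : ℕ} (h : M < j) : gaussBinom Q M j = 0 := by
  induction M generalizing j with
  | zero => obtain ⟨j, rfl⟩ := Nat.exists_eq_succ_of_ne_zero h.ne'; rfl
  | succ M ih =>
    obtain ⟨j, rfl⟩ := Nat.exists_eq_succ_of_ne_zero (Nat.ne_zero_of_lt h)
    rw [Nat.succ_eq_add_one, gaussBinom_succ_succ, ih (by omega), ih (by omega)]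
    simp

lemma eulerProd_succ (Q : ℂ) (n : ℕ) :
    eulerProd Q (n + 1) = eulerProd Q n * (1 - Q ^ (n + 1)) :=
  Finset.prod_range_succ _ _

lemma gaussBinom_mul_eulerProd (Q : ℂ) (j m : ℕ) :
    gaussBinom Q (j + m) j * eulerProd Q j * eulerProd Q m = eulerProd Q (j + m) := by
  induction h : j + m generalizing j m with
  | zero =>
    obtain ⟨rfl, rfl⟩ : j = 0 ∧ m = 0 := by omega
    simp [gaussBinom_zero_right, eulerProd]
  | succ M ih =>
    rcases j with _ | j
    · obtain rfl : m = M + 1 := by omega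
      simp [gaussBinom_zero_right, eulerProd]
    have h₁ := ih j m (by omega)
    rw [gaussBinom_succ_succ, eulerProd_succ Q M, eulerProd_succ Q j]
    rcases m with _ | m
    · obtain rfl : j = M := by omega
      rw [gaussBinom_eq_zero_of_lt Q (Nat.lt_succ_self j)]
      linear_combination (1 - Q ^ (j + 1)) * h₁
    · have h₂ := ih (j + 1) m (by omega)
      obtain rfl : M = j + m + 1 := by omega
      rw [eulerProd_succ Q j] at h₂
      rw [eulerProd_succ Q m] at h₁ ⊢
      linear_combination (1 - Q ^ (j + 1)) * h₁ + Q ^ (j + 1) * (1 - Q ^ (m + 1)) * h₂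

/-- The `q`-binomial theorem. -/
lemma prod_one_add_mul_pow_odd (q x : ℂ) (M : ℕ) :
    ∏ i ∈ Finset.range M, (1 + x * q ^ (2 * i + 1)) =
      ∑ j ∈ Finset.range (M + 1), q ^ (j ^ 2) * gaussBinom (q ^ 2) M j * x ^ j := by
  induction M generalizing x with
  | zero => simp [gaussBinom_zero_right]
  | succ M ih =>
    have h : ∏ i ∈ Finset.range M, (1 + x * q ^ (2 * (i + 1) + 1)) =
        ∏ i ∈ Finset.range M, (1 + x * q ^ 2 * q ^ (2 * i + 1)) :=
      Finset.prod_congr rfl fun i _ ↦ by ring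
    rw [Finset.prod_range_succ', h, ih, mul_add, Finset.sum_range_succ' _ (M + 1)]
    have h₀ : ∑ j ∈ Finset.range (M + 1), q ^ (j ^ 2) * gaussBinom (q ^ 2) M j * (x * q ^ 2) ^ j =
        ∑ j ∈ Finset.range (M + 1), q ^ ((j + 1) ^ 2) * gaussBinom (q ^ 2) M (j + 1) *
          (x * q ^ 2) ^ (j + 1) + 1 := by
      have := Finset.sum_range_succ'
        (fun j ↦ q ^ (j ^ 2) * gaussBinom (q ^ 2) M j * (x * q ^ 2) ^ j) (M + 1)
      rw [Finset.sum_range_succ, gaussBinom_eq_zero_of_lt _ (Nat.lt_succ_self M)] at this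
      simpa [gaussBinom_zero_right] using this
    nth_rw 1 [h₀]
    simp only [gaussBinom_succ_succ, gaussBinom_zero_right]
    rw [mul_one, add_right_comm, Finset.sum_mul, ← Finset.sum_add_distrib]
    congr 1
    · exact Finset.sum_congr rfl fun j _ ↦ by ring
    · simp

lemma prod_one_add_mul_inv_pow_odd {q z : ℂ} (hq : q ≠ 0) (hz : z ≠ 0) (N : ℕ) :
    (∏ i ∈ Finset.range N, (1 + z * (q ^ (2 * i + 1))⁻¹)) * q ^ (N ^ 2) =
      z ^ N * ∏ i ∈ Finset.range N, (1 + z⁻¹ * q ^ (2 * i + 1)) := by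
  induction N with
  | zero => simp
  | succ N ih =>
    rw [Finset.prod_range_succ, Finset.prod_range_succ]
    have h : (1 + z * (q ^ (2 * N + 1))⁻¹) * q ^ (2 * N + 1) =
        z * (1 + z⁻¹ * q ^ (2 * N + 1)) := by
      field_simp
      ring
    calc _ = ((∏ i ∈ Finset.range N, (1 + z * (q ^ (2 * i + 1))⁻¹)) * q ^ (N ^ 2)) *
          ((1 + z * (q ^ (2 * N + 1))⁻¹) * q ^ (2 * N + 1)) := by ring
      _ = _ := by rw [ih, h]; ring

/-- The finite form of the Jacobi triple product. -/
lemma prod_mul_prod_eq_sum_gaussBinom {q z : ℂ} (hq : q ≠ 0) (hz : z ≠ 0) (N : ℕ) :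
    (∏ i ∈ Finset.range N, (1 + z * q ^ (2 * i + 1))) *
        ∏ i ∈ Finset.range N, (1 + z⁻¹ * q ^ (2 * i + 1)) =
      ∑ j ∈ Finset.range (2 * N + 1), gaussBinom (q ^ 2) (2 * N) j *
        (q ^ (((j : ℤ) - N) ^ 2) * z ^ ((j : ℤ) - N)) := by
  have hprod : ∏ i ∈ Finset.range (2 * N), (1 + z * (q ^ (2 * N))⁻¹ * q ^ (2 * i + 1)) =
      (∏ i ∈ Finset.range N, (1 + z * (q ^ (2 * i + 1))⁻¹)) *
        ∏ i ∈ Finset.range N, (1 + z * q ^ (2 * i + 1)) := by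
    rw [two_mul N, Finset.prod_range_add,
      ← Finset.prod_range_reflect (fun i ↦ 1 + z * (q ^ (N + N))⁻¹ * q ^ (2 * i + 1))]
    congr 1
    · refine Finset.prod_congr rfl fun i hi ↦ ?_
      have hi := Finset.mem_range.mp hi
      have : q ^ (N + N) = q ^ (2 * (N - 1 - i) + 1) * q ^ (2 * i + 1) := by
        rw [← pow_add]; congr 1; omega
      rw [this]
      field_simp
    · refine Finset.prod_congr rfl fun i _ ↦ ?_
      field_simp
      ring
  rw [prod_one_add_mul_pow_odd] at hprod
  have h := prod_one_add_mul_inv_pow_odd hq hz N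
  have hzN : z ^ N ≠ 0 := pow_ne_zero _ hz
  apply mul_left_cancel₀ hzN
  rw [mul_left_comm, ← h, mul_comm (∏ i ∈ Finset.range N, (1 + z * (q ^ (2 * i + 1))⁻¹)),
    mul_left_comm, mul_comm (∏ i ∈ Finset.range N, (1 + z * q ^ (2 * i + 1))), ← hprod,
    Finset.mul_sum, Finset.mul_sum]
  refine Finset.sum_congr rfl fun j _ ↦ ?_
  have e₁ : q ^ (((j : ℤ) - N) ^ 2) = q ^ (j ^ 2) * q ^ (N ^ 2) * ((q ^ (2 * N)) ^ j)⁻¹ := by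
    simp only [← zpow_natCast, ← zpow_mul, ← zpow_neg, ← zpow_add₀ hq]
    congr 1
    push_cast
    ring
  have e₂ : z ^ ((j : ℤ) - N) = z ^ j * (z ^ N)⁻¹ := by
    rw [zpow_sub₀ hz, zpow_natCast, zpow_natCast, div_eq_mul_inv]
  rw [e₁, e₂, mul_pow, inv_pow]
  field_simp

lemma one_sub_pow_succ_ne_zero {Q : ℂ} (hQ : ‖Q‖ < 1) (n : ℕ) : 1 - Q ^ (n + 1) ≠ 0 := by
  intro h
  have h₁ : ‖Q ^ (n + 1)‖ < 1 := by
    rw [norm_pow]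
    exact pow_lt_one₀ (norm_nonneg _) hQ (by omega)
  rw [← sub_eq_zero.mp h] at h₁
  simp at h₁

lemma eulerProd_ne_zero {Q : ℂ} (hQ : ‖Q‖ < 1) (n : ℕ) : eulerProd Q n ≠ 0 :=
  Finset.prod_ne_zero_iff.mpr fun i _ ↦ one_sub_pow_succ_ne_zero hQ i

lemma tprod_one_sub_pow_ne_zero {Q : ℂ} (hQ : ‖Q‖ < 1) : ∏' n : ℕ, (1 - Q ^ (n + 1)) ≠ 0 := by
  have := tprod_one_add_ne_zero_of_summable (f := fun n : ℕ ↦ -Q ^ (n + 1))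
    (fun i ↦ by simpa [← sub_eq_add_neg] using one_sub_pow_succ_ne_zero hQ i)
    (by
      simpa using (summable_nat_add_iff 1).mpr
        (summable_geometric_of_lt_one (norm_nonneg _) hQ))
  simpa [← sub_eq_add_neg] using this

lemma tendsto_eulerProd {Q : ℂ} (hQ : ‖Q‖ < 1) :
    Tendsto (eulerProd Q) atTop (𝓝 (∏' n : ℕ, (1 - Q ^ (n + 1)))) :=
  (ModularForm.multipliable_one_sub_pow hQ).tendsto_prod_tprod_nat

lemma gaussBinom_eq {Q : ℂ} (hQ : ‖Q‖ < 1) (j m : ℕ) :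
    gaussBinom Q (j + m) j = eulerProd Q (j + m) * (eulerProd Q j)⁻¹ * (eulerProd Q m)⁻¹ := by
  rw [← gaussBinom_mul_eulerProd]
  field_simp [eulerProd_ne_zero hQ]

lemma exists_norm_gaussBinom_le {Q : ℂ} (hQ : ‖Q‖ < 1) :
    ∃ C, ∀ M j, ‖gaussBinom Q M j‖ ≤ C := by
  have hlim := tendsto_eulerProd hQ
  obtain ⟨a, ha⟩ := (Metric.isBounded_range_of_tendsto _ hlim).exists_norm_le
  obtain ⟨b, hb⟩ := (Metric.isBounded_range_of_tendsto _
    (hlim.inv₀ (tprod_one_sub_pow_ne_zero hQ))).exists_norm_le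
  have ha' (n) : ‖eulerProd Q n‖ ≤ a := ha _ ⟨n, rfl⟩
  have hb' (n) : ‖(eulerProd Q n)⁻¹‖ ≤ b := hb _ ⟨n, rfl⟩
  have ha₀ : 0 ≤ a := (norm_nonneg _).trans (ha' 0)
  have hb₀ : 0 ≤ b := (norm_nonneg _).trans (hb' 0)
  refine ⟨a * b * b, fun M j ↦ ?_⟩
  rcases lt_or_ge M j with h | h
  · rw [gaussBinom_eq_zero_of_lt Q h, norm_zero]
    positivity
  · obtain ⟨m, rfl⟩ := Nat.exists_eq_add_of_le h
    rw [gaussBinom_eq hQ, norm_mul, norm_mul]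
    gcongr
    exacts [ha' _, hb' _, hb' _]

lemma tendsto_gaussBinom_central {Q : ℂ} (hQ : ‖Q‖ < 1) (k : ℤ) :
    Tendsto (fun N : ℕ ↦ gaussBinom Q (2 * N) (N + k).toNat) atTop
      (𝓝 (∏' n : ℕ, (1 - Q ^ (n + 1)))⁻¹) := by
  have hL := tprod_one_sub_pow_ne_zero hQ
  have hlim := tendsto_eulerProd hQ
  have h₀ : Tendsto (fun N : ℕ ↦ 2 * N) atTop atTop :=
    tendsto_id.const_mul_atTop' two_pos
  have h₁ (l : ℤ) : Tendsto (fun N : ℕ ↦ (N + l).toNat) atTop atTop :=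
    tendsto_atTop_atTop.mpr fun b ↦ ⟨b + l.natAbs, fun a ha ↦ by omega⟩
  have h := ((hlim.comp h₀).mul ((hlim.comp (h₁ k)).inv₀ hL)).mul ((hlim.comp (h₁ (-k))).inv₀ hL)
  rw [mul_inv_cancel₀ hL, one_mul] at h
  refine h.congr' ?_
  filter_upwards [eventually_ge_atTop k.natAbs] with N hN
  have e : 2 * N = (N + k).toNat + (N + -k).toNat := by omega
  simp only [Function.comp_apply]
  rw [e, gaussBinom_eq hQ]

lemma sum_gaussBinom_eq_tsum (q z : ℂ) (N : ℕ) :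
    ∑ j ∈ Finset.range (2 * N + 1), gaussBinom (q ^ 2) (2 * N) j *
        (q ^ (((j : ℤ) - N) ^ 2) * z ^ ((j : ℤ) - N)) =
      ∑' k : ℤ, (if -(N : ℤ) ≤ k then gaussBinom (q ^ 2) (2 * N) (N + k).toNat else 0) *
        (q ^ (k ^ 2) * z ^ k) := by
  rw [tsum_eq_sum (s := Finset.Icc (-(N : ℤ)) N)]
  · refine Finset.sum_bij (fun j _ ↦ (j : ℤ) - N) ?_ ?_ ?_ ?_
    · intro j hj
      simp only [Finset.mem_range, Finset.mem_Icc] at hj ⊢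
      omega
    · intro i _ j _ h
      omega
    · intro k hk
      simp only [Finset.mem_Icc] at hk
      exact ⟨(N + k).toNat, by simp only [Finset.mem_range]; omega, by omega⟩
    · intro j _
      rw [if_pos (by omega), add_sub_cancel, Int.toNat_natCast]
  · intro k hk
    simp only [Finset.mem_Icc, not_and, not_le] at hk
    split_ifs with h
    · rw [gaussBinom_eq_zero_of_lt _ (by have := hk h; omega), zero_mul]
    · exact zero_mul _

lemma multipliable_one_add_mul_pow_odd {q : ℂ} (hq : ‖q‖ < 1) (z : ℂ) :
    Multipliable fun n : ℕ ↦ 1 + z * q ^ (2 * n + 1) := by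
  refine multipliable_one_add_of_summable (Summable.congr (f := fun n : ℕ ↦
    ‖z * q‖ * (‖q‖ ^ 2) ^ n) ?_ fun n ↦ ?_)
  · exact (summable_geometric_of_lt_one (by positivity)
      (pow_lt_one₀ (norm_nonneg _) hq two_ne_zero)).mul_left _
  · simp only [norm_mul, norm_pow]
    ring

/-- The Jacobi triple product. -/
theorem tsum_zpow_sq_mul_zpow {q z : ℂ} (hq₀ : q ≠ 0) (hq : ‖q‖ < 1) (hz : z ≠ 0)
    (hs : Summable fun k : ℤ ↦ q ^ (k ^ 2) * z ^ k) :
    ∑' k : ℤ, q ^ (k ^ 2) * z ^ k =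
      (∏' n : ℕ, (1 - (q ^ 2) ^ (n + 1))) * ((∏' n : ℕ, (1 + z * q ^ (2 * n + 1))) *
        ∏' n : ℕ, (1 + z⁻¹ * q ^ (2 * n + 1))) := by
  have hQ : ‖q ^ 2‖ < 1 := by
    rw [norm_pow]
    exact pow_lt_one₀ (norm_nonneg _) hq two_ne_zero
  obtain ⟨C, hC⟩ := exists_norm_gaussBinom_le hQ
  have hC₀ : 0 ≤ C := (norm_nonneg _).trans (hC 0 0)
  have hprod := (multipliable_one_add_mul_pow_odd hq z).tendsto_prod_tprod_nat.mul
    (multipliable_one_add_mul_pow_odd hq z⁻¹).tendsto_prod_tprod_nat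
  have hsum := tendsto_tsum_of_dominated_convergence (𝓕 := atTop) (f := fun (N : ℕ) (k : ℤ) ↦
      (if -(N : ℤ) ≤ k then gaussBinom (q ^ 2) (2 * N) (N + k).toNat else 0) *
        (q ^ (k ^ 2) * z ^ k))
    (g := fun k ↦ (∏' n : ℕ, (1 - (q ^ 2) ^ (n + 1)))⁻¹ * (q ^ (k ^ 2) * z ^ k))
    (hs.norm.mul_left C) (fun k ↦ ?_) (.of_forall fun N k ↦ ?_)
  · simp_rw [prod_mul_prod_eq_sum_gaussBinom hq₀ hz, sum_gaussBinom_eq_tsum] at hprod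
    rw [tendsto_nhds_unique hprod hsum, tsum_mul_left,
      mul_inv_cancel_left₀ (tprod_one_sub_pow_ne_zero hQ)]
  · refine ((tendsto_gaussBinom_central hQ k).congr' ?_).mul_const _
    filter_upwards [eventually_ge_atTop k.natAbs] with N hN
    rw [if_pos (by omega)]
  · rw [norm_mul]
    gcongr
    split_ifs
    · exact hC _ _
    · simpa using hC₀

/-- The Jacobi triple product for `jacobiTheta₂`. -/
theorem jacobiTheta₂_eq_tprod {τ : ℂ} (hτ : 0 < τ.im) (w : ℂ) {q z : ℂ}
    (hq : q = exp (Real.pi * I * τ)) (hz : z = exp (2 * Real.pi * I * w)) :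
    jacobiTheta₂ w τ =
      (∏' n : ℕ, (1 - (q ^ 2) ^ (n + 1))) * ((∏' n : ℕ, (1 + z * q ^ (2 * n + 1))) *
        ∏' n : ℕ, (1 + z⁻¹ * q ^ (2 * n + 1))) := by
  have hterm (k : ℤ) : jacobiTheta₂_term k w τ = q ^ (k ^ 2) * z ^ k := by
    rw [hq, hz, jacobiTheta₂_term, ← exp_int_mul, ← exp_int_mul, ← exp_add]
    congr 1
    push_cast
    ring
  have hs := (summable_jacobiTheta₂_term_iff w τ).mpr hτ
  simp_rw [hterm] at hs
  simp_rw [jacobiTheta₂, hterm]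
  refine tsum_zpow_sq_mul_zpow (hq ▸ exp_ne_zero _) ?_ (hz ▸ exp_ne_zero _) hs
  rw [hq, norm_exp, Real.exp_lt_one_iff]
  have : (Real.pi * I * τ).re = -(Real.pi * τ.im) := by simp
  rw [this]
  have := mul_pos Real.pi_pos hτ
  linarith

lemma thetaC3_eq_jacobiTheta₂ (τ : ℂ) : thetaC3 τ = jacobiTheta₂ 0 τ := by
  refine tsum_congr fun k ↦ ?_
  rw [jacobiTheta₂_term]
  congr 1
  ring

lemma thetaC4_eq_jacobiTheta₂ (τ : ℂ) : thetaC4 τ = jacobiTheta₂ (1 / 2) τ := by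
  refine tsum_congr fun k ↦ ?_
  rw [jacobiTheta₂_term, ← exp_pi_mul_I, ← exp_int_mul, ← exp_add]
  congr 1
  ring

lemma thetaC2_eq_jacobiTheta₂ (τ : ℂ) :
    thetaC2 τ = exp (Real.pi * I * τ / 4) * jacobiTheta₂ (τ / 2) τ := by
  rw [thetaC2, jacobiTheta₂, ← tsum_mul_left]
  refine tsum_congr fun k ↦ ?_
  rw [jacobiTheta₂_term, ← exp_add]
  congr 1
  ring

/-- Euler's identity `∏ (1 + q ^ n) (1 - q ^ (2n - 1)) = 1`, with the first factor split by the
parity of the exponent. -/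
lemma tprod_one_add_mul_one_sub_odd {q : ℂ} (hq : ‖q‖ < 1) :
    (∏' n : ℕ, (1 + q ^ (2 * n + 1))) * (∏' n : ℕ, (1 - q ^ (2 * n + 1))) *
      ∏' n : ℕ, (1 + q ^ (2 * n + 2)) = 1 := by
  have hQ : ‖q ^ 2‖ < 1 := by
    rw [norm_pow]
    exact pow_lt_one₀ (norm_nonneg _) hq two_ne_zero
  have hB : Multipliable fun n : ℕ ↦ 1 + q ^ (2 * n + 1) := by
    simpa using multipliable_one_add_mul_pow_odd hq 1
  have hC : Multipliable fun n : ℕ ↦ 1 - q ^ (2 * n + 1) := by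
    simpa [← sub_eq_add_neg] using multipliable_one_add_mul_pow_odd hq (-1)
  have hD : Multipliable fun n : ℕ ↦ 1 + q ^ (2 * n + 2) :=
    (multipliable_one_add_mul_pow_odd hq q).congr fun n ↦ by ring
  have hA := ModularForm.multipliable_one_sub_pow hQ
  have hBC := hB.mul hC
  have hAD := hA.mul hD
  have hsplit := tprod_even_mul_odd (f := fun n : ℕ ↦ 1 - (q ^ 2) ^ (n + 1))
    (hBC.congr fun n ↦ by ring) (hAD.congr fun n ↦ by ring)
  have e₁ : ∏' n : ℕ, (1 - (q ^ 2) ^ (2 * n + 1)) =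
      (∏' n : ℕ, (1 + q ^ (2 * n + 1))) * ∏' n : ℕ, (1 - q ^ (2 * n + 1)) := by
    rw [← hB.tprod_mul hC]
    exact tprod_congr fun n ↦ by ring
  have e₂ : ∏' n : ℕ, (1 - (q ^ 2) ^ (2 * n + 1 + 1)) =
      (∏' n : ℕ, (1 - (q ^ 2) ^ (n + 1))) * ∏' n : ℕ, (1 + q ^ (2 * n + 2)) := by
    rw [← hA.tprod_mul hD]
    exact tprod_congr fun n ↦ by ring
  rw [e₁, e₂] at hsplit
  apply mul_left_cancel₀ (tprod_one_sub_pow_ne_zero hQ)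
  linear_combination hsplit

theorem two_eta_cubed (τ : ℂ) (hτ : 0 < τ.im) :
    2 * dedekindEta τ ^ 3 = thetaC2 τ * thetaC3 τ * thetaC4 τ := by
  obtain ⟨q, hq⟩ : ∃ q, q = exp (Real.pi * I * τ) := ⟨_, rfl⟩
  have hq₁ : ‖q‖ < 1 := by
    rw [hq, norm_exp, Real.exp_lt_one_iff]
    have := mul_pos Real.pi_pos hτ
    simpa using this
  have hq₀ : q ≠ 0 := hq ▸ exp_ne_zero _
  have h₃ := jacobiTheta₂_eq_tprod hτ 0 hq (z := 1) (by simp)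
  have h₄ := jacobiTheta₂_eq_tprod hτ (1 / 2) hq (z := -1) (by
    rw [← exp_pi_mul_I]; congr 1; ring)
  have h₂ := jacobiTheta₂_eq_tprod hτ (τ / 2) hq (z := q) (by
    rw [hq]; congr 1; ring)
  have hD : Multipliable fun n : ℕ ↦ 1 + q ^ (2 * n + 2) :=
    (multipliable_one_add_mul_pow_odd hq₁ q).congr fun n ↦ by ring
  have e₁ : ∏' n : ℕ, (1 + q * q ^ (2 * n + 1)) = ∏' n : ℕ, (1 + q ^ (2 * n + 2)) :=
    tprod_congr fun n ↦ by ring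
  have e₂ : ∏' n : ℕ, (1 + q⁻¹ * q ^ (2 * n + 1)) = 2 * ∏' n : ℕ, (1 + q ^ (2 * n + 2)) := by
    have h := tprod_eq_zero_mul' (f := fun n : ℕ ↦ 1 + q ^ (2 * n)) hD
    rw [tprod_congr (g := fun n : ℕ ↦ 1 + q ^ (2 * n)) fun n ↦ by field_simp; ring, h]
    norm_num [mul_add]
  rw [e₁, e₂] at h₂
  simp only [inv_one, one_mul, inv_neg, neg_mul, ← sub_eq_add_neg] at h₃ h₄
  have hη : dedekindEta τ = exp (Real.pi * I * τ / 12) * ∏' n : ℕ, (1 - (q ^ 2) ^ (n + 1)) := by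
    rw [dedekindEta]
    congr 1
    refine tprod_congr fun n ↦ ?_
    rw [hq, ← exp_nat_mul, ← exp_nat_mul]
    congr 2
    push_cast
    ring
  have hexp : exp (Real.pi * I * τ / 4) = exp (Real.pi * I * τ / 12) ^ 3 := by
    rw [← exp_nat_mul]
    congr 1
    push_cast
    ring
  have hone := tprod_one_add_mul_one_sub_odd hq₁
  rw [thetaC2_eq_jacobiTheta₂, thetaC3_eq_jacobiTheta₂, thetaC4_eq_jacobiTheta₂, h₂, h₃, h₄, hη,
    hexp]
  generalize (∏' n : ℕ, (1 + q ^ (2 * n + 1))) = B at *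
  generalize (∏' n : ℕ, (1 - q ^ (2 * n + 1))) = C at *
  generalize (∏' n : ℕ, (1 + q ^ (2 * n + 2))) = D at *
  generalize (∏' n : ℕ, (1 - (q ^ 2) ^ (n + 1))) = A at *
  linear_combination (-2 * exp (Real.pi * I * τ / 12) ^ 3 * A ^ 3 * (B * C * D + 1)) * hone
end
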